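/- There exist seven lines L₀, …, L₆ in ℝ³, pairwise non-parallel, such that for every pair i ≠ j the infimum distance between Lᵢ and Lⱼ equals 2. Equivalently, there exists a configuration of seven mutually touching infinitely long straight round cylinders all of the same radius 1 (the 7*-knot). -/

import Mathlib

/-- The infimum of the Euclidean distance between points of the line `{p₁ + t • v₁}`
and points of the line `{p₂ + t • v₂}`. -/
noncomputable def lineDist (p₁ v₁ p₂ v₂ : EuclideanSpace ℝ (Fin 3)) : ℝ :=
  sInf {d : ℝ | ∃ t₁ t₂ : ℝ, d = dist (p₁ + t₁ • v₁) (p₂ + t₂ • v₂)}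

/-- The cross product of two vectors, in coordinates. -/
def normal {R : Type*} [CommRing R] (v w : Fin 3 → R) : Fin 3 → R :=
  ![v 1 * w 2 - v 2 * w 1, v 2 * w 0 - v 0 * w 2, v 0 * w 1 - v 1 * w 0]

/-- The dot product of two vectors, in coordinates. -/
def dot {R : Type*} [CommRing R] (a b : Fin 3 → R) : R :=
  a 0 * b 0 + a 1 * b 1 + a 2 * b 2

/-- For `s = r ^ 2` this vanishes when the skew lines through `p`, `q` with directions `v`, `w`
are at distance `r`. -/
def defect {R : Type*} [CommRing R] (s : R) (p v q w : Fin 3 → R) : R :=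
  dot (p - q) (normal v w) * dot (p - q) (normal v w) - s * dot (normal v w) (normal v w)

/-- The derivative of `defect s` at `(p, v, q, w)` in the direction `(p', v', q', w')`. -/
def defectDeriv {R : Type*} [CommRing R] (s : R) (p v q w p' v' q' w' : Fin 3 → R) : R :=
  2 * dot (p - q) (normal v w) *
      (dot (p' - q') (normal v w) + dot (p - q) (normal v' w + normal v w')) -
    s * (2 * dot (normal v w) (normal v' w + normal v w'))

/-- `d` approximates `f - f'` to second order, where `f` and `f'` are values within `L * δ` of a
reference value `a`: here `δ` bounds the displacement from the reference configuration, `η` bounds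
the displacement between the two configurations, `A` bounds the reference value, `L` is a Lipschitz
constant and `K` bounds the error of the linear approximation. -/
structure FirstOrder (δ η A L K a d f f' : ℝ) : Prop where
  abs_le : |a| ≤ A
  near : |f - a| ≤ L * δ
  near' : |f' - a| ≤ L * δ
  lipschitz : |f - f'| ≤ L * η
  approx : |f - f' - d| ≤ K * δ * η

namespace FirstOrder

variable {δ η A₁ L₁ K₁ a₁ d₁ f₁ f₁' A₂ L₂ K₂ a₂ d₂ f₂ f₂' : ℝ}

lemma add (h₁ : FirstOrder δ η A₁ L₁ K₁ a₁ d₁ f₁ f₁') (h₂ : FirstOrder δ η A₂ L₂ K₂ a₂ d₂ f₂ f₂') :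
    FirstOrder δ η (A₁ + A₂) (L₁ + L₂) (K₁ + K₂) (a₁ + a₂) (d₁ + d₂) (f₁ + f₂) (f₁' + f₂') where
  abs_le := (abs_add_le _ _).trans (add_le_add h₁.abs_le h₂.abs_le)
  near := by
    rw [add_sub_add_comm, add_mul]
    exact (abs_add_le _ _).trans (add_le_add h₁.near h₂.near)
  near' := by
    rw [add_sub_add_comm, add_mul]
    exact (abs_add_le _ _).trans (add_le_add h₁.near' h₂.near')
  lipschitz := by
    rw [add_sub_add_comm, add_mul]
    exact (abs_add_le _ _).trans (add_le_add h₁.lipschitz h₂.lipschitz)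
  approx := by
    rw [add_sub_add_comm, add_sub_add_comm, add_mul, add_mul]
    exact (abs_add_le _ _).trans (add_le_add h₁.approx h₂.approx)

lemma neg (h : FirstOrder δ η A₁ L₁ K₁ a₁ d₁ f₁ f₁') :
    FirstOrder δ η A₁ L₁ K₁ (-a₁) (-d₁) (-f₁) (-f₁') where
  abs_le := by rw [abs_neg]; exact h.abs_le
  near := by rw [← neg_sub', abs_neg]; exact h.near
  near' := by rw [← neg_sub', abs_neg]; exact h.near'
  lipschitz := by rw [← neg_sub', abs_neg]; exact h.lipschitz
  approx := by rw [← neg_sub', ← neg_sub', abs_neg]; exact h.approx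

lemma sub (h₁ : FirstOrder δ η A₁ L₁ K₁ a₁ d₁ f₁ f₁') (h₂ : FirstOrder δ η A₂ L₂ K₂ a₂ d₂ f₂ f₂') :
    FirstOrder δ η (A₁ + A₂) (L₁ + L₂) (K₁ + K₂) (a₁ - a₂) (d₁ - d₂) (f₁ - f₂) (f₁' - f₂') := by
  simpa only [sub_eq_add_neg] using h₁.add h₂.neg

lemma const_mul {s : ℝ} (hs : 0 ≤ s) (h : FirstOrder δ η A₁ L₁ K₁ a₁ d₁ f₁ f₁') :
    FirstOrder δ η (s * A₁) (s * L₁) (s * K₁) (s * a₁) (s * d₁) (s * f₁) (s * f₁') where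
  abs_le := by
    rw [abs_mul, abs_of_nonneg hs]; exact mul_le_mul_of_nonneg_left h.abs_le hs
  near := by
    rw [← mul_sub, abs_mul, abs_of_nonneg hs, mul_assoc]
    exact mul_le_mul_of_nonneg_left h.near hs
  near' := by
    rw [← mul_sub, abs_mul, abs_of_nonneg hs, mul_assoc]
    exact mul_le_mul_of_nonneg_left h.near' hs
  lipschitz := by
    rw [← mul_sub, abs_mul, abs_of_nonneg hs, mul_assoc]
    exact mul_le_mul_of_nonneg_left h.lipschitz hs
  approx := by
    rw [← mul_sub, ← mul_sub, abs_mul, abs_of_nonneg hs, mul_assoc, mul_assoc, ← mul_assoc K₁]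
    exact mul_le_mul_of_nonneg_left h.approx hs

lemma abs_value_le (h : FirstOrder δ η A₁ L₁ K₁ a₁ d₁ f₁ f₁') (hδ₁ : δ ≤ 1) (hL : 0 ≤ L₁) :
    |f₁| ≤ A₁ + L₁ := by
  have := abs_add_le (f₁ - a₁) a₁
  rw [sub_add_cancel] at this
  nlinarith [h.near, h.abs_le]

lemma symm (h : FirstOrder δ η A₁ L₁ K₁ a₁ d₁ f₁ f₁') :
    FirstOrder δ η A₁ L₁ K₁ a₁ (-d₁) f₁' f₁ where
  abs_le := h.abs_le
  near := h.near'
  near' := h.near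
  lipschitz := by rw [abs_sub_comm]; exact h.lipschitz
  approx := by
    rw [← abs_neg, show -(f₁' - f₁ - -d₁) = f₁ - f₁' - d₁ by ring]; exact h.approx

lemma mul (hδ : 0 ≤ δ) (hδ₁ : δ ≤ 1) (hL₁ : 0 ≤ L₁) (hL₂ : 0 ≤ L₂)
    (h₁ : FirstOrder δ η A₁ L₁ K₁ a₁ d₁ f₁ f₁') (h₂ : FirstOrder δ η A₂ L₂ K₂ a₂ d₂ f₂ f₂') :
    FirstOrder δ η (A₁ * A₂) ((A₁ + L₁) * L₂ + (A₂ + L₂) * L₁) (2 * L₁ * L₂ + A₁ * K₂ + A₂ * K₁)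
      (a₁ * a₂) (a₁ * d₂ + a₂ * d₁) (f₁ * f₂) (f₁' * f₂') := by
  have hA₁ : 0 ≤ A₁ := (abs_nonneg _).trans h₁.abs_le
  have hA₂ : 0 ≤ A₂ := (abs_nonneg _).trans h₂.abs_le
  have hf₁ := h₁.abs_value_le hδ₁ hL₁
  have hf₁' := h₁.symm.abs_value_le hδ₁ hL₁
  have bound {x y X Y : ℝ} (hx : |x| ≤ X) (hy : |y| ≤ Y) : |x * y| ≤ X * Y := by
    rw [abs_mul]
    exact mul_le_mul hx hy (abs_nonneg _) ((abs_nonneg _).trans hx)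
  refine ⟨bound h₁.abs_le h₂.abs_le, ?_, ?_, ?_, ?_⟩
  · rw [show f₁ * f₂ - a₁ * a₂ = f₁ * (f₂ - a₂) + a₂ * (f₁ - a₁) by ring]
    refine (abs_add_le _ _).trans ((add_le_add (bound hf₁ h₂.near)
      (bound h₂.abs_le h₁.near)).trans ?_)
    nlinarith [mul_nonneg (mul_nonneg hL₂ hL₁) hδ]
  · rw [show f₁' * f₂' - a₁ * a₂ = f₁' * (f₂' - a₂) + a₂ * (f₁' - a₁) by ring]
    refine (abs_add_le _ _).trans ((add_le_add (bound hf₁' h₂.near')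
      (bound h₂.abs_le h₁.near')).trans ?_)
    nlinarith [mul_nonneg (mul_nonneg hL₂ hL₁) hδ]
  · rw [show f₁ * f₂ - f₁' * f₂' = f₁ * (f₂ - f₂') + f₂' * (f₁ - f₁') by ring]
    exact (abs_add_le _ _).trans ((add_le_add (bound hf₁ h₂.lipschitz)
      (bound (h₂.symm.abs_value_le hδ₁ hL₂) h₁.lipschitz)).trans_eq (by ring))
  · rw [show f₁ * f₂ - f₁' * f₂' - (a₁ * d₂ + a₂ * d₁) =
      (f₂ - a₂) * (f₁ - f₁') + (f₁' - a₁) * (f₂ - f₂') + a₂ * (f₁ - f₁' - d₁) +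
        a₁ * (f₂ - f₂' - d₂) by ring]
    refine (abs_add_le _ _).trans (add_le_add ((abs_add_le _ _).trans (add_le_add
      ((abs_add_le _ _).trans (add_le_add (bound h₂.near h₁.lipschitz)
        (bound h₁.near' h₂.lipschitz))) (bound h₂.abs_le h₁.approx)))
      (bound h₁.abs_le h₂.approx)) |>.trans_eq (by ring)

end FirstOrder

lemma firstOrder_dot {δ η A₁ L₁ K₁ A₂ L₂ K₂ : ℝ} {a d f f' b e g g' : Fin 3 → ℝ}
    (hδ : 0 ≤ δ) (hδ₁ : δ ≤ 1) (hL₁ : 0 ≤ L₁) (hL₂ : 0 ≤ L₂)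
    (h₁ : ∀ c, FirstOrder δ η A₁ L₁ K₁ (a c) (d c) (f c) (f' c))
    (h₂ : ∀ c, FirstOrder δ η A₂ L₂ K₂ (b c) (e c) (g c) (g' c)) :
    FirstOrder δ η (3 * (A₁ * A₂)) (3 * ((A₁ + L₁) * L₂ + (A₂ + L₂) * L₁))
      (3 * (2 * L₁ * L₂ + A₁ * K₂ + A₂ * K₁))
      (dot a b) (dot a e + dot b d) (dot f g) (dot f' g') := by
  have h c := (h₁ c).mul hδ hδ₁ hL₁ hL₂ (h₂ c)
  convert ((h 0).add (h 1)).add (h 2) using 1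
  · ring
  · ring
  · ring
  · rfl
  · simp only [dot]
    ring
  · rfl
  · rfl

lemma firstOrder_normal {δ η : ℝ} {v v' g g' w w' k k' : Fin 3 → ℝ}
    (hδ : 0 ≤ δ) (hδ₁ : δ ≤ 1)
    (h₁ : ∀ c, FirstOrder δ η 1 1 0 (v c) (v' c) (g c) (g' c))
    (h₂ : ∀ c, FirstOrder δ η 1 1 0 (w c) (w' c) (k c) (k' c)) (c : Fin 3) :
    FirstOrder δ η 2 8 4 (normal v w c) ((normal v' w + normal v w') c)
      (normal g k c) (normal g' k' c) := by
  have h i j := ((h₁ i).mul hδ hδ₁ zero_le_one zero_le_one (h₂ j)).sub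
    ((h₁ j).mul hδ hδ₁ zero_le_one zero_le_one (h₂ i))
  fin_cases c
  · convert h 1 2 using 1 <;> simp [normal] <;> ring
  · convert h 2 0 using 1 <;> simp [normal] <;> ring
  · convert h 0 1 using 1 <;> simp [normal] <;> ring

lemma firstOrder_dot_normal_self {δ η : ℝ} {v v' g g' w w' k k' : Fin 3 → ℝ}
    (hδ : 0 ≤ δ) (hδ₁ : δ ≤ 1)
    (hv : ∀ c, FirstOrder δ η 1 1 0 (v c) (v' c) (g c) (g' c))
    (hw : ∀ c, FirstOrder δ η 1 1 0 (w c) (w' c) (k c) (k' c)) :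
    FirstOrder δ η 12 480 432 (dot (normal v w) (normal v w))
      (2 * dot (normal v w) (normal v' w + normal v w'))
      (dot (normal g k) (normal g k))
      (dot (normal g' k') (normal g' k')) := by
  have hn := firstOrder_normal hδ hδ₁ hv hw
  convert firstOrder_dot hδ hδ₁ (by norm_num) (by norm_num) hn hn using 1 <;> ring

lemma firstOrder_defect {δ η : ℝ} {p p' f f' v v' g g' q q' h h' w w' k k' : Fin 3 → ℝ}
    (hδ : 0 ≤ δ) (hδ₁ : δ ≤ 1)
    (hp : ∀ c, FirstOrder δ η 4 1 0 (p c) (p' c) (f c) (f' c))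
    (hv : ∀ c, FirstOrder δ η 1 1 0 (v c) (v' c) (g c) (g' c))
    (hq : ∀ c, FirstOrder δ η 4 1 0 (q c) (q' c) (h c) (h' c))
    (hw : ∀ c, FirstOrder δ η 1 1 0 (w c) (w' c) (k c) (k' c)) :
    FirstOrder δ η 2352 210720 200160 (defect 4 p v q w) (defectDeriv 4 p v q w p' v' q' w')
      (defect 4 f g h k) (defect 4 f' g' h' k') := by
  have hn := firstOrder_normal hδ hδ₁ hv hw
  have hd := firstOrder_dot (a := p - q) (d := p' - q') (f := f - h) (f' := f' - h')
    hδ hδ₁ (by norm_num) (by norm_num) (fun c => (hp c).sub (hq c)) hn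
  have hd2 := hd.mul hδ hδ₁ (by norm_num) (by norm_num) hd
  convert hd2.sub ((firstOrder_dot_normal_self hδ hδ₁ hv hw).const_mul zero_le_four) using 1
  · norm_num
  · norm_num
  · norm_num
  · rfl
  · simp only [defectDeriv, dot]
    ring
  · rfl
  · rfl

lemma defectDeriv_sum {ι : Type*} [Fintype ι] (s : ℝ) (p v q w : Fin 3 → ℝ) (z : ι → ℝ)
    (p' v' q' w' : ι → Fin 3 → ℝ) :
    defectDeriv s p v q w (fun c => ∑ l, z l * p' l c) (fun c => ∑ l, z l * v' l c)
      (fun c => ∑ l, z l * q' l c) (fun c => ∑ l, z l * w' l c) =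
    ∑ l, z l * defectDeriv s p v q w (p' l) (v' l) (q' l) (w' l) := by
  simp only [defectDeriv, dot, normal, Pi.sub_apply, Pi.add_apply, Matrix.cons_val,
    Finset.mul_sum, Finset.sum_mul, ← Finset.sum_add_distrib, ← Finset.sum_sub_distrib]
  exact Finset.sum_congr rfl fun l _ => by ring

lemma dot_normal_div {N : ℝ} (hN : N ≠ 0) (v w : Fin 3 → ℤ) :
    dot (normal (fun c => v c / N) (fun c => w c / N))
      (normal (fun c => v c / N) (fun c => w c / N)) =
    ((dot (normal v w) (normal v w) : ℤ) : ℝ) / N ^ 4 := by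
  simp only [dot, normal, Matrix.cons_val]
  push_cast
  field_simp

lemma defect_div {N : ℝ} (hN : N ≠ 0) {s : ℝ} {S : ℤ} (hS : S = s * N ^ 2)
    (p v q w : Fin 3 → ℤ) :
    defect s (fun c => p c / N) (fun c => v c / N) (fun c => q c / N) (fun c => w c / N) =
      (defect S p v q w : ℤ) / N ^ 6 := by
  simp only [defect, dot, normal, Matrix.cons_val, Pi.sub_apply]
  push_cast
  rw [hS]
  field_simp

lemma defectDeriv_div {N M : ℝ} (hN : N ≠ 0) (hM : M ≠ 0) {s : ℝ} {S : ℤ} (hS : S = s * N ^ 2)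
    (p v q w p' v' q' w' : Fin 3 → ℤ) :
    defectDeriv s (fun c => p c / N) (fun c => v c / N) (fun c => q c / N) (fun c => w c / N)
        (fun c => p' c / M) (fun c => v' c / M) (fun c => q' c / M) (fun c => w' c / M) =
      (defectDeriv S p v q w p' v' q' w' : ℤ) / (N ^ 5 * M) := by
  simp only [defectDeriv, dot, normal, Matrix.cons_val, Pi.sub_apply, Pi.add_apply]
  push_cast
  rw [hS]
  field_simp

/-- A map close to the identity on a closed ball, and small at its centre, has a zero. -/
lemma exists_zero_of_approx_id {E : Type*} [NormedAddCommGroup E] [CompleteSpace E] {g : E → E}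
    {ε : ℝ} (hε : 0 ≤ ε) (h0 : ‖g 0‖ ≤ ε / 2)
    (h : ∀ y y', ‖y‖ ≤ ε → ‖y'‖ ≤ ε → ‖g y - g y' - (y - y')‖ ≤ 1 / 2 * ‖y - y'‖) :
    ∃ y, ‖y‖ ≤ ε ∧ g y = 0 := by
  have maps : Set.MapsTo (fun y => y - g y) (Metric.closedBall 0 ε) (Metric.closedBall 0 ε) := by
    intro y hy
    rw [mem_closedBall_zero_iff] at hy ⊢
    have h1 := h y 0 hy (by simpa using hε)
    rw [sub_zero] at h1
    calc ‖y - g y‖ = ‖-(g y - g 0 - y) - g 0‖ := by congr 1; abel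
      _ ≤ ‖g y - g 0 - y‖ + ‖g 0‖ := by rw [← norm_neg (g y - g 0 - y)]; exact norm_sub_le _ _
      _ ≤ ε := by linarith
  have contr : ContractingWith (1 / 2) (maps.restrict _ _ _) := by
    refine ⟨by rw [← NNReal.coe_lt_coe]; norm_num, LipschitzWith.of_dist_le_mul fun y y' => ?_⟩
    have hyy := h y y' (mem_closedBall_zero_iff.1 y.2) (mem_closedBall_zero_iff.1 y'.2)
    rw [← norm_neg, show -(g y - g y' - ((y : E) - y')) = y - g y - (y' - g y') by abel] at hyy
    rw [Subtype.dist_eq, Subtype.dist_eq, dist_eq_norm, dist_eq_norm]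
    exact hyy.trans_eq (by simp)
  obtain ⟨y, hy, hfix, -⟩ := contr.exists_fixedPoint' Metric.isClosed_closedBall.isComplete maps
    (x := 0) (Metric.mem_closedBall_self hε) (edist_ne_top _ _)
  exact ⟨y, mem_closedBall_zero_iff.1 hy, by simpa [Function.IsFixedPt] using hfix⟩

lemma linearIndependent_of_dot_normal {v w : Fin 3 → ℝ} (h : dot (normal v w) (normal v w) ≠ 0) :
    LinearIndependent ℝ ![WithLp.toLp 2 v, WithLp.toLp 2 w] := by
  rw [LinearIndependent.pair_iff]
  intro s t hst
  have hc (c : Fin 3) : s * v c + t * w c = 0 := by simpa using congrArg (fun x => x c) hst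
  have h0 := hc 0
  have h1 := hc 1
  have h2 := hc 2
  simp only [dot, normal, Matrix.cons_val] at h
  constructor
  · refine (mul_eq_zero.1 ?_).resolve_right h
    grind
  · refine (mul_eq_zero.1 ?_).resolve_right h
    grind

lemma lineDist_eq_two {p v q w : Fin 3 → ℝ} (hn : 0 < dot (normal v w) (normal v w))
    (h : defect 4 p v q w = 0) :
    lineDist (WithLp.toLp 2 p) (WithLp.toLp 2 v) (WithLp.toLp 2 q) (WithLp.toLp 2 w) = 2 := by
  have hd (t₁ t₂ : ℝ) : dist (WithLp.toLp 2 p + t₁ • WithLp.toLp 2 v)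
      (WithLp.toLp 2 q + t₂ • WithLp.toLp 2 w) =
      √(dot (p - q + t₁ • v - t₂ • w) (p - q + t₁ • v - t₂ • w)) := by
    rw [EuclideanSpace.dist_eq, Fin.sum_univ_three]
    simp only [Real.dist_eq, sq_abs, dot, PiLp.add_apply, PiLp.smul_apply, Pi.add_apply,
      Pi.sub_apply, Pi.smul_apply, smul_eq_mul]
    congr 1
    ring
  have two_eq : (2 : ℝ) = √4 := by
    rw [show (4 : ℝ) = 2 ^ 2 by norm_num, Real.sqrt_sq zero_le_two]
  refine IsLeast.csInf_eq ⟨?_, ?_⟩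
  · set n := normal v w with hn_def
    refine ⟨-(dot (normal (p - q) w) n / dot n n), -(dot (normal (p - q) v) n / dot n n), ?_⟩
    rw [hd, two_eq]
    congr 1
    have key : p - q + -(dot (normal (p - q) w) n / dot n n) • v -
        -(dot (normal (p - q) v) n / dot n n) • w = (dot (p - q) n / dot n n) • n := by
      rw [← sub_eq_zero]
      have hn' := hn.ne'
      ext c
      simp only [Pi.sub_apply, Pi.add_apply, Pi.smul_apply, smul_eq_mul, Pi.zero_apply]
      rw [← mul_right_inj' hn']
      field_simp
      fin_cases c <;> simp [hn_def, normal, dot] <;> ring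
    rw [key]
    have : dot ((dot (p - q) n / dot n n) • n) ((dot (p - q) n / dot n n) • n) =
        dot (p - q) n * dot (p - q) n / dot n n := by
      rw [show dot ((dot (p - q) n / dot n n) • n) ((dot (p - q) n / dot n n) • n) =
        (dot (p - q) n / dot n n) ^ 2 * dot n n by simp only [dot, Pi.smul_apply, smul_eq_mul]; ring]
      field_simp
    rw [this, eq_comm, div_eq_iff hn.ne']
    exact sub_eq_zero.1 h
  · rintro _ ⟨t₁, t₂, rfl⟩
    rw [hd, two_eq]
    refine Real.sqrt_le_sqrt (le_of_mul_le_mul_right ?_ hn)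
    rw [← sub_eq_zero.1 h]
    set e := p - q + t₁ • v - t₂ • w with he
    have h1 : dot (p - q) (normal v w) = dot e (normal v w) := by
      simp [he, dot, normal]; ring
    rw [h1, ← sub_nonneg]
    have : dot e e * dot (normal v w) (normal v w) -
        dot e (normal v w) * dot e (normal v w) =
          dot (normal e (normal v w)) (normal e (normal v w)) := by
      simp only [dot, normal, Matrix.cons_val]; ring
    rw [this]
    simp only [dot]
    nlinarith

/-- Points of seven lines that nearly touch each other, scaled by `10 ^ 11`. -/
def basePoint : Fin 7 → Fin 3 → ℤ :=
  ![![-99138788736, -103830655129, 28203447643],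
    ![-97608711383, 133616754646, -36197936875],
    ![102388266008, -92321065721, 195782811801],
    ![-184226680293, -313603923282, -359696799547],
    ![-254903159479, -184003582682, -100378449494],
    ![-87257523378, -97972172917, 347958953598],
    ![-329105078842, 304171492242, 59360381405]]

/-- Directions of seven lines that nearly touch each other, scaled by `10 ^ 11`. -/
def baseDir : Fin 7 → Fin 3 → ℤ :=
  ![![-56640306292, 67083979373, 47870820075],
    ![14008665831, 35295135553, 92509516743],
    ![14824347426, 92214616666, 35730983704],
    ![61239813352, -72397071241, 31754516787],
    ![-29682330657, 74027317568, -60323424143],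
    ![39011922390, -90717704618, -15759694805],
    ![52880871175, 42926780684, 73218201042]]

/-- Displacements of the points, scaled by `1000`: together with `dirShift`, row `l` changes the
defect of the `l`-th pair at unit rate, and the other defects hardly at all. -/
def pointShift : Fin 21 → Fin 7 → Fin 3 → ℤ :=
  ![![![-3, -272, 377], ![187, 274, -133], ![251, -73, 85], ![-211, -283, -238],
      ![275, -181, -358], ![17, -32, 226], ![-516, 567, 40]],
    ![![-52, 26, -98], ![-14, 71, -25], ![153, -79, 142], ![-49, -55, -32],
      ![28, -91, -125], ![34, -12, 150], ![-100, 140, -10]],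
    ![![-12, -9, -2], ![-138, 102, -18], ![217, -116, 210], ![-9, -86, -179],
      ![-61, -14, 13], ![36, 12, 17], ![-33, 111, -42]],
    ![![48, 23, 25], ![140, -92, 14], ![-44, 41, -87], ![-85, -43, 65],
      ![147, 45, -17], ![-85, -27, -57], ![-122, 53, 57]],
    ![![-9, 77, -118], ![-125, 87, -14], ![-94, 18, -8], ![67, 106, 113],
      ![-111, 52, 119], ![-24, 3, -78], ![297, -343, -13]],
    ![![8, -57, 89], ![-147, 94, -14], ![138, -69, 121], ![23, -97, -265],
      ![-81, 11, 53], ![57, 11, 80], ![2, 108, -64]],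
    ![![101, -5, 126], ![-114, 179, -51], ![145, -77, 138], ![-17, -85, -161],
      ![-114, -153, -131], ![46, -3, 129], ![-46, 142, -50]],
    ![![-1, -49, 67], ![230, -161, 27], ![53, 1, -26], ![-49, -73, -73],
      ![64, -35, -75], ![15, 0, 41], ![-312, 317, 39]],
    ![![15, -19, 44], ![-64, 33, -3], ![80, -23, 27], ![21, -37, -125],
      ![-64, 46, 88], ![-15, -5, -9], ![26, 4, -22]],
    ![![85, -175, 345], ![89, -23, -5], ![380, -125, 164], ![-195, -418, -577],
      ![207, -4, -107], ![22, -26, 206], ![-589, 770, -26]],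
    ![![-177, 90, -336], ![-300, 50, 26], ![17, -69, 170], ![224, 188, -3],
      ![-361, 2, 180], ![179, 64, 74], ![418, -325, -111]],
    ![![-20, 100, -165], ![-118, 33, 5], ![8, -38, 94], ![84, 80, 21],
      ![-179, 60, 162], ![-6, 14, -97], ![231, -249, -20]],
    ![![-55, -174, 179], ![-324, 283, -59], ![489, -150, 183], ![-9, -301, -669],
      ![-94, -149, -137], ![155, -56, 706], ![-162, 546, -203]],
    ![![-2, 115, -164], ![247, -192, 36], ![-301, 153, -269], ![3, 209, 470],
      ![102, 53, 15], ![-140, -25, -205], ![92, -313, 117]],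
    ![![-63, 58, -156], ![108, -122, 30], ![-204, 82, -126], ![50, 166, 281],
      ![0, 15, 19], ![1, 17, -96], ![108, -215, 48]],
    ![![-20, 54, -100], ![-110, -51, 36], ![-82, 18, -12], ![106, 112, 50],
      ![-146, 51, 134], ![28, 24, -68], ![224, -207, -41]],
    ![![1, -153, 216], ![81, 41, -28], ![411, -182, 298], ![-147, -310, -424],
      ![112, -126, -209], ![95, 12, 169], ![-553, 718, -22]],
    ![![8, 44, -52], ![171, -122, 21], ![-180, 120, -235], ![0, 114, 260],
      ![73, 23, -8], ![-95, -31, -55], ![22, -147, 70]],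
    ![![-11, 54, -87], ![-36, 3, 4], ![-109, 43, -65], ![65, 110, 124],
      ![-74, 50, 98], ![-32, 1, -85], ![196, -260, 11]],
    ![![13, -44, 78], ![116, -57, 4], ![74, -20, 20], ![-70, -94, -79],
      ![98, -52, -112], ![17, -5, 70], ![-248, 271, 20]],
    ![![20, -7, 33], ![158, -78, 6], ![-90, 83, -178], ![-58, 19, 154],
      ![148, -17, -94], ![-82, -41, 34], ![-97, 41, 46]]]

/-- Displacements of the directions, scaled by `1000`; see `pointShift`. -/
def dirShift : Fin 21 → Fin 7 → Fin 3 → ℤ :=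
  ![![![197, 158, 13], ![-112, 200, -59], ![-165, 44, -46], ![-163, -284, -332],
      ![61, 298, 336], ![-177, -48, -164], ![-89, 153, -25]],
    ![![40, 12, 30], ![-3, 13, -4], ![-50, 21, -34], ![-24, -33, -27],
      ![-9, 44, 58], ![-20, -8, -4], ![-3, -3, 4]],
    ![![-24, 5, -36], ![24, -33, 9], ![61, -36, 67], ![19, 29, 29],
      ![-35, -47, -41], ![41, 10, 43], ![16, -37, 10]],
    ![![16, 6, 10], ![-83, 122, -34], ![-55, 19, -27], ![-52, -99, -127],
      ![41, 98, 100], ![-44, -12, -37], ![-49, 112, -30]],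
    ![![-88, -67, -10], ![61, -144, 46], ![70, -15, 9], ![69, 126, 155],
      ![-20, -133, -154], ![75, 19, 78], ![38, -65, 10]],
    ![![-32, 12, -54], ![63, -106, 31], ![3, 8, -21], ![15, 24, 25],
      ![-50, -49, -36], ![52, 13, 56], ![60, -124, 29]],
    ![![19, 22, -8], ![64, -82, 22], ![8, -5, 10], ![-8, 2, 20],
      ![-22, 7, 20], ![-21, -6, -17], ![37, -93, 28]],
    ![![57, 45, 4], ![-95, 139, -39], ![-68, 15, -10], ![-40, -88, -123],
      ![-2, 99, 123], ![-42, -8, -57], ![-29, 54, -11]],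
    ![![-21, 0, -25], ![13, -30, 9], ![-22, 8, -12], ![11, 23, 30],
      ![-1, -47, -58], ![20, 5, 17], ![4, -26, 12]],
    ![![99, 120, -52], ![-56, 104, -31], ![-147, 39, -40], ![-61, -111, -135],
      ![-11, 237, 296], ![-72, -16, -87], ![8, -61, 30]],
    ![![-261, -129, -128], ![196, -296, 83], ![164, -52, 66], ![152, 282, 351],
      ![-96, -286, -304], ![140, 39, 125], ![124, -262, 64]],
    ![![-124, -78, -37], ![113, -126, 31], ![106, -38, 53], ![99, 167, 189],
      ![-59, -181, -194], ![124, 33, 117], ![51, -93, 17]],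
    ![![-4, 72, -105], ![138, -260, 78], ![-43, 15, -20], ![-42, -25, 24],
      ![-125, -16, 42], ![87, 9, 165], ![145, -357, 105]],
    ![![20, -37, 76], ![-111, 194, -57], ![4, 4, -11], ![11, -20, -69],
      ![94, 66, 35], ![-80, -25, -53], ![-92, 253, -82]],
    ![![-20, -36, 27], ![-46, 61, -17], ![27, -7, 6], ![11, 7, -5],
      ![60, 25, 1], ![18, 4, 18], ![-34, 96, -31]],
    ![![-88, -92, 25], ![68, -111, 32], ![80, -24, 29], ![74, 132, 158],
      ![-33, -138, -153], ![74, 20, 67], ![47, -91, 19]],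
    ![![99, 118, -48], ![18, -4, -1], ![-59, -12, 55], ![-77, -152, -199],
      ![-23, 138, 181], ![-52, -14, -52], ![-61, 94, -11]],
    ![![32, -12, 54], ![-72, 103, -28], ![0, 20, -51], ![-21, -25, -17],
      ![70, 42, 17], ![-60, -15, -63], ![-71, 124, -21]],
    ![![-47, -42, 3], ![21, -40, 12], ![44, -2, -13], ![27, 66, 98],
      ![4, -67, -85], ![27, 4, 46], ![14, 16, -19]],
    ![![56, 41, 9], ![-37, 66, -19], ![-34, 6, 0], ![-35, -70, -90],
      ![20, 70, 76], ![-45, -10, -54], ![1, 0, 0]],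
    ![![79, 33, 47], ![-101, 148, -41], ![-63, 26, -41], ![-49, -101, -134],
      ![61, 125, 124], ![-84, -16, -116], ![-60, 150, -44]]]

/-- The smaller index in the `k`-th pair of lines. -/
def fstIdx : Fin 21 → Fin 7 :=
  ![0, 0, 1, 0, 1, 2, 0, 1, 2, 3, 0, 1, 2, 3, 4, 0, 1, 2, 3, 4, 5]

/-- The larger index in the `k`-th pair of lines. -/
def sndIdx : Fin 21 → Fin 7 :=
  ![1, 2, 2, 3, 3, 3, 4, 4, 4, 4, 5, 5, 5, 5, 5, 6, 6, 6, 6, 6, 6]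

lemma exists_idx : ∀ i j : Fin 7, i < j → ∃ k, fstIdx k = i ∧ sndIdx k = j := by decide +kernel

lemma abs_basePoint_le : ∀ i c, |basePoint i c| ≤ 4 * 10 ^ 11 := by decide +kernel

lemma abs_baseDir_le : ∀ i c, |baseDir i c| ≤ 10 ^ 11 := by decide +kernel

lemma abs_pointShift_le : ∀ l i c, |pointShift l i c| ≤ 1000 := by decide +kernel

lemma abs_dirShift_le : ∀ l i c, |dirShift l i c| ≤ 1000 := by decide +kernel

lemma normal_base_ge : ∀ k, 10 ^ 43 ≤
    dot (normal (baseDir (fstIdx k)) (baseDir (sndIdx k)))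
      (normal (baseDir (fstIdx k)) (baseDir (sndIdx k))) := by decide +kernel

lemma abs_defect_base_le : ∀ k, |defect (4 * 10 ^ 22) (basePoint (fstIdx k)) (baseDir (fstIdx k))
    (basePoint (sndIdx k)) (baseDir (sndIdx k))| ≤ 5 * 10 ^ 56 := by decide +kernel

lemma abs_defectDeriv_base_sub_le : ∀ k l,
    |defectDeriv (4 * 10 ^ 22) (basePoint (fstIdx k)) (baseDir (fstIdx k))
      (basePoint (sndIdx k)) (baseDir (sndIdx k))
      (pointShift l (fstIdx k)) (dirShift l (fstIdx k))
      (pointShift l (sndIdx k)) (dirShift l (sndIdx k)) -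
      if k = l then 10 ^ 58 else 0| ≤ 18 * 10 ^ 55 := by decide +kernel

/-- The points of the seven lines of the perturbed configuration with parameter `y`. -/
noncomputable def knotPoint (y : Fin 21 → ℝ) (i : Fin 7) (c : Fin 3) : ℝ :=
  basePoint i c / 10 ^ 11 + ∑ l, y l * (pointShift l i c / 1000)

/-- The directions of the seven lines of the perturbed configuration with parameter `y`. -/
noncomputable def knotDir (y : Fin 21 → ℝ) (i : Fin 7) (c : Fin 3) : ℝ :=
  baseDir i c / 10 ^ 11 + ∑ l, y l * (dirShift l i c / 1000)

lemma abs_sum_mul_le {y b : Fin 21 → ℝ} (hb : ∀ l, |b l| ≤ 1) : |∑ l, y l * b l| ≤ 21 * ‖y‖ := by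
  calc |∑ l, y l * b l| ≤ ∑ l, |y l * b l| := Finset.abs_sum_le_sum_abs _ _
    _ ≤ ∑ _l : Fin 21, ‖y‖ := Finset.sum_le_sum fun l _ => by
        rw [abs_mul, ← mul_one ‖y‖]
        exact mul_le_mul (norm_le_pi_norm y l) (hb l) (abs_nonneg _) (norm_nonneg _)
    _ = 21 * ‖y‖ := by simp

lemma firstOrder_affine {ε A a : ℝ} {b y y' : Fin 21 → ℝ} (ha : |a| ≤ A) (hb : ∀ l, |b l| ≤ 1)
    (hy : ‖y‖ ≤ ε) (hy' : ‖y'‖ ≤ ε) :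
    FirstOrder (21 * ε) (21 * ‖y - y'‖) A 1 0 a (∑ l, (y - y') l * b l)
      (a + ∑ l, y l * b l) (a + ∑ l, y' l * b l) := by
  have hsub : a + ∑ l, y l * b l - (a + ∑ l, y' l * b l) = ∑ l, (y - y') l * b l := by
    simp only [Pi.sub_apply, sub_mul, Finset.sum_sub_distrib]
    ring
  refine ⟨ha, ?_, ?_, ?_, ?_⟩
  · rw [add_sub_cancel_left, one_mul]
    exact (abs_sum_mul_le hb).trans (by linarith)
  · rw [add_sub_cancel_left, one_mul]
    exact (abs_sum_mul_le hb).trans (by linarith)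
  · rw [hsub, one_mul]
    exact abs_sum_mul_le hb
  · rw [hsub, sub_self, abs_zero, zero_mul, zero_mul]

lemma abs_intCast_div_le {n : ℤ} {N b : ℝ} (hN : 0 < N) {B : ℤ} (h : |n| ≤ B) (hB : B ≤ b * N) :
    |(n : ℝ) / N| ≤ b := by
  rw [abs_div, abs_of_pos hN, div_le_iff₀ hN]
  exact le_trans (by exact_mod_cast h) hB

lemma firstOrder_knotPoint {ε : ℝ} {y y' : Fin 21 → ℝ} (hy : ‖y‖ ≤ ε) (hy' : ‖y'‖ ≤ ε)
    (i : Fin 7) (c : Fin 3) :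
    FirstOrder (21 * ε) (21 * ‖y - y'‖) 4 1 0 (basePoint i c / 10 ^ 11)
      (∑ l, (y - y') l * (pointShift l i c / 1000)) (knotPoint y i c) (knotPoint y' i c) :=
  firstOrder_affine
    (abs_intCast_div_le (by norm_num) (abs_basePoint_le i c) (by norm_num))
    (fun l => abs_intCast_div_le (by norm_num) (abs_pointShift_le l i c) (by norm_num)) hy hy'

lemma firstOrder_knotDir {ε : ℝ} {y y' : Fin 21 → ℝ} (hy : ‖y‖ ≤ ε) (hy' : ‖y'‖ ≤ ε)
    (i : Fin 7) (c : Fin 3) :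
    FirstOrder (21 * ε) (21 * ‖y - y'‖) 1 1 0 (baseDir i c / 10 ^ 11)
      (∑ l, (y - y') l * (dirShift l i c / 1000)) (knotDir y i c) (knotDir y' i c) :=
  firstOrder_affine
    (abs_intCast_div_le (by norm_num) (abs_baseDir_le i c) (by norm_num))
    (fun l => abs_intCast_div_le (by norm_num) (abs_dirShift_le l i c) (by norm_num)) hy hy'

/-- The system of equations expressing that the seven lines are pairwise at distance two. -/
noncomputable def knotDefect (y : Fin 21 → ℝ) (k : Fin 21) : ℝ :=
  defect 4 (knotPoint y (fstIdx k)) (knotDir y (fstIdx k))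
    (knotPoint y (sndIdx k)) (knotDir y (sndIdx k))

lemma norm_knotDefect_zero_le : ‖knotDefect 0‖ ≤ 1 / 10 ^ 9 / 2 := by
  refine (pi_norm_le_iff_of_nonneg (by norm_num)).2 fun k => ?_
  have hp i : knotPoint 0 i = fun c => (basePoint i c : ℝ) / 10 ^ 11 := by
    ext c; simp [knotPoint]
  have hv i : knotDir 0 i = fun c => (baseDir i c : ℝ) / 10 ^ 11 := by
    ext c; simp [knotDir]
  rw [knotDefect, hp, hp, hv, hv, defect_div (S := 4 * 10 ^ 22) (by norm_num) (by norm_num)]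
  exact abs_intCast_div_le (by norm_num) (abs_defect_base_le k) (by norm_num)

lemma knotDefect_approx_id {y y' : Fin 21 → ℝ} (hy : ‖y‖ ≤ 1 / 10 ^ 9) (hy' : ‖y'‖ ≤ 1 / 10 ^ 9) :
    ‖knotDefect y - knotDefect y' - (y - y')‖ ≤ 1 / 2 * ‖y - y'‖ := by
  refine (pi_norm_le_iff_of_nonneg (by positivity)).2 fun k => ?_
  have h := (firstOrder_defect (by norm_num) (by norm_num)
    (firstOrder_knotPoint hy hy' (fstIdx k)) (firstOrder_knotDir hy hy' (fstIdx k))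
    (firstOrder_knotPoint hy hy' (sndIdx k)) (firstOrder_knotDir hy hy' (sndIdx k))).approx
  rw [defectDeriv_sum] at h
  have hk : (y - y') k = ∑ l, (y - y') l * if k = l then 1 else 0 := by simp
  have hd : |∑ l, (y - y') l * defectDeriv (4 : ℝ)
        (fun c => (basePoint (fstIdx k) c : ℝ) / 10 ^ 11) (fun c => baseDir (fstIdx k) c / 10 ^ 11)
        (fun c => basePoint (sndIdx k) c / 10 ^ 11) (fun c => baseDir (sndIdx k) c / 10 ^ 11)
        (fun c => pointShift l (fstIdx k) c / 1000) (fun c => dirShift l (fstIdx k) c / 1000)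
        (fun c => pointShift l (sndIdx k) c / 1000) (fun c => dirShift l (sndIdx k) c / 1000) -
      (y - y') k| ≤ 21 * ‖(18 / 1000 : ℝ) • (y - y')‖ := by
    rw [hk, ← Finset.sum_sub_distrib]
    simp only [← mul_sub]
    rw [show ∀ t : Fin 21 → ℝ, ∑ l, (y - y') l * t l =
      ∑ l, ((18 / 1000 : ℝ) • (y - y')) l * (1000 / 18 * t l) from fun t =>
        Finset.sum_congr rfl fun l _ => by simp only [Pi.smul_apply, smul_eq_mul]; ring]
    refine abs_sum_mul_le fun l => ?_
    rw [defectDeriv_div (S := 4 * 10 ^ 22) (by norm_num) (by norm_num) (by norm_num), abs_mul]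
    have hb := abs_intCast_div_le (N := 10 ^ 58) (b := 18 / 1000) (by norm_num)
      (abs_defectDeriv_base_sub_le k l) (by norm_num)
    rw [Int.cast_sub, sub_div] at hb
    have : (((if k = l then 10 ^ 58 else 0 : ℤ) : ℝ)) / 10 ^ 58 = if k = l then 1 else 0 := by
      split_ifs <;> norm_num
    rw [this] at hb
    norm_num at hb ⊢
    linarith
  rw [norm_smul, Real.norm_of_nonneg (by norm_num)] at hd
  rw [Real.norm_eq_abs, Pi.sub_apply, Pi.sub_apply]
  refine (abs_sub_le _ _ _).trans ((add_le_add h hd).trans ?_)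
  have := norm_nonneg (y - y')
  norm_num
  linarith

lemma normal_knotDir_pos {y : Fin 21 → ℝ} (hy : ‖y‖ ≤ 1 / 10 ^ 9) (k : Fin 21) :
    0 < dot (normal (knotDir y (fstIdx k)) (knotDir y (sndIdx k)))
      (normal (knotDir y (fstIdx k)) (knotDir y (sndIdx k))) := by
  have h := (firstOrder_dot_normal_self (by norm_num) (by norm_num)
    (firstOrder_knotDir hy hy (fstIdx k)) (firstOrder_knotDir hy hy (sndIdx k))).near
  rw [dot_normal_div (by norm_num)] at h
  have hb : (1 / 10 : ℝ) ≤ ((dot (normal (baseDir (fstIdx k)) (baseDir (sndIdx k)))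
      (normal (baseDir (fstIdx k)) (baseDir (sndIdx k))) : ℤ) : ℝ) / (10 ^ 11) ^ 4 := by
    rw [le_div_iff₀ (by norm_num)]
    refine le_trans ?_ (Int.cast_le.2 (normal_base_ge k))
    norm_num
  have := (abs_le.1 h).1
  norm_num at this hb
  linarith

lemma lineDist_comm (p₁ v₁ p₂ v₂ : EuclideanSpace ℝ (Fin 3)) :
    lineDist p₁ v₁ p₂ v₂ = lineDist p₂ v₂ p₁ v₁ := by
  unfold lineDist
  congr 1
  ext d
  exact ⟨fun ⟨s, t, h⟩ => ⟨t, s, h.trans (dist_comm _ _)⟩,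
    fun ⟨s, t, h⟩ => ⟨t, s, h.trans (dist_comm _ _)⟩⟩

/-- Seven mutually touching infinite straight round cylinders of equal radius 1
(the 7*-knot): seven pairwise non-parallel lines with pairwise infimum distance 2. -/
theorem stmt8 :
    ∃ p v : Fin 7 → EuclideanSpace ℝ (Fin 3),
      (∀ i, v i ≠ 0) ∧
      (∀ i j, i ≠ j → LinearIndependent ℝ ![v i, v j]) ∧
      (∀ i j, i ≠ j → lineDist (p i) (v i) (p j) (v j) = 2) := by
  obtain ⟨y, hy, hzero⟩ := exists_zero_of_approx_id (by norm_num) norm_knotDefect_zero_le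
    fun y y' hy hy' => knotDefect_approx_id hy hy'
  have main (i j : Fin 7) (hij : i < j) :
      LinearIndependent ℝ ![WithLp.toLp 2 (knotDir y i), WithLp.toLp 2 (knotDir y j)] ∧
      lineDist (WithLp.toLp 2 (knotPoint y i)) (WithLp.toLp 2 (knotDir y i))
        (WithLp.toLp 2 (knotPoint y j)) (WithLp.toLp 2 (knotDir y j)) = 2 := by
    obtain ⟨k, rfl, rfl⟩ := exists_idx i j hij
    have hn := normal_knotDir_pos hy k
    exact ⟨linearIndependent_of_dot_normal hn.ne', lineDist_eq_two hn (congrFun hzero k)⟩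
  have indep (i j : Fin 7) (hij : i ≠ j) :
      LinearIndependent ℝ ![WithLp.toLp 2 (knotDir y i), WithLp.toLp 2 (knotDir y j)] := by
    rcases hij.lt_or_gt with h | h
    · exact (main i j h).1
    · exact LinearIndependent.pair_symm_iff.1 (main j i h).1
  refine ⟨fun i => WithLp.toLp 2 (knotPoint y i), fun i => WithLp.toLp 2 (knotDir y i),
    fun i => ?_, indep, fun i j hij => ?_⟩
  · obtain ⟨j, hj⟩ := exists_ne i
    exact (indep i j hj.symm).ne_zero 0
  · rcases hij.lt_or_gt with h | h
    · exact (main i j h).2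
    · rw [lineDist_comm]
      exact (main j i h).2
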